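/- Let G be an almost Moore digraph of degree d > 1 and diameter k > 1 and let α > 1 be an integer. Then for every vertex v of H_α, the out-degree of v within H_α equals the in-degree of v within H_α. -/

import Mathlib

/-- `IsWalkFrom A u v l` : the list `u :: l` is a directed walk from `u` to `v`
along the adjacency relation `A`; the length of the walk is `l.length`. -/
def IsWalkFrom {V : Type} (A : V → V → Prop) (u v : V) (l : List V) : Prop :=
  List.Chain A u l ∧ (u :: l).getLast (List.cons_ne_nil u l) = v

/-- An almost Moore digraph (a `(d,k)`-digraph): a diregular digraph of degree `d > 1`,
diameter `k > 1` and order `d + d² + ⋯ + d^k`, together with its repeat permutation `rep`: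
for every vertex `v`, every vertex `w ≠ rep v` is reached from `v` by exactly one walk of
length at most `k`, while `rep v` is reached by exactly two such walks, at least one of
which has length `k`.  The map `rep` is an automorphism of the digraph. -/
structure AlmostMooreDigraph (d k : ℕ) where
  hd : 1 < d
  hk : 1 < k
  V : Type
  [fintypeV : Fintype V]
  [decEqV : DecidableEq V]
  Adj : V → V → Prop
  [adjDec : DecidableRel Adj]
  loopless : ∀ v, ¬ Adj v v
  out_deg : ∀ v, {w | Adj v w}.ncard = d
  in_deg : ∀ v, {w | Adj w v}.ncard = d
  reach : ∀ u v, ∃ l, IsWalkFrom Adj u v l ∧ l.length ≤ k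
  diam : ∃ u v, ∀ l, IsWalkFrom Adj u v l → k ≤ l.length
  card_eq : Fintype.card V = ∑ i ∈ Finset.range k, d ^ (i + 1)
  rep : V → V
  rep_spec : ∀ v w, w ≠ rep v → ∃! l, IsWalkFrom Adj v w l ∧ l.length ≤ k
  rep_two : ∀ v, ∃ l₁ l₂, l₁ ≠ l₂ ∧
      IsWalkFrom Adj v (rep v) l₁ ∧ l₁.length ≤ k ∧
      IsWalkFrom Adj v (rep v) l₂ ∧ l₂.length ≤ k ∧
      (l₁.length = k ∨ l₂.length = k) ∧
      (∀ l, IsWalkFrom Adj v (rep v) l → l.length ≤ k → l = l₁ ∨ l = l₂)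
  rep_bijective : Function.Bijective rep
  rep_adj : ∀ u v, Adj u v ↔ Adj (rep u) (rep v)

attribute [instance] AlmostMooreDigraph.fintypeV AlmostMooreDigraph.decEqV
  AlmostMooreDigraph.adjDec

/-- `ordRep M v` : the smallest `t ≥ 1` with `rep^t v = v`. -/
noncomputable def ordRep {d k : ℕ} (M : AlmostMooreDigraph d k) (v : M.V) : ℕ :=
  sInf {t | 0 < t ∧ M.rep^[t] v = v}

/-- The vertex set of the subdigraph `H_α`: vertices whose order under the repeat
permutation divides `2^t * α` for some `t ≥ 0`. -/
def Hset {d k : ℕ} (M : AlmostMooreDigraph d k) (α : ℕ) : Set M.V :=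
  {v | ∃ t : ℕ, ordRep M v ∣ 2 ^ t * α}

section Walks

variable {V : Type} {A B : V → V → Prop} {u v w : V} {l : List V}

theorem isWalkFrom_nil : IsWalkFrom A u v [] ↔ u = v := by
  simp [IsWalkFrom, List.Chain]

theorem isWalkFrom_cons : IsWalkFrom A u v (w :: l) ↔ A u w ∧ IsWalkFrom A w v l := by
  simp [IsWalkFrom, List.Chain, List.getLast_cons, and_assoc]

/-- The image of a walk under a map preserving adjacency is a walk. -/
theorem IsWalkFrom.map {f : V → V} (hf : ∀ x y, A x y → A (f x) (f y))
    (h : IsWalkFrom A u v l) : IsWalkFrom A (f u) (f v) (l.map f) := by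
  induction l generalizing u with
  | nil => rw [isWalkFrom_nil] at h; simp [isWalkFrom_nil, h]
  | cons x l ih =>
    rw [isWalkFrom_cons] at h
    rw [List.map_cons, isWalkFrom_cons]
    exact ⟨hf _ _ h.1, ih h.2⟩

theorem IsWalkFrom.mono (hAB : ∀ x y, A x y → B x y) (h : IsWalkFrom A u v l) :
    IsWalkFrom B u v l := by
  induction l generalizing u with
  | nil => rw [isWalkFrom_nil] at h ⊢; exact h
  | cons x l ih =>
    rw [isWalkFrom_cons] at h ⊢
    exact ⟨hAB _ _ h.1, ih h.2⟩

/-- A walk all of whose vertices lie in `S` is a walk in the restriction of the relation to `S`. -/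
theorem IsWalkFrom.restrict {S : Set V} (hu : u ∈ S) (hl : ∀ x ∈ l, x ∈ S)
    (h : IsWalkFrom A u v l) :
    IsWalkFrom (fun x y => A x y ∧ x ∈ S ∧ y ∈ S) u v l := by
  induction l generalizing u with
  | nil => rw [isWalkFrom_nil] at h ⊢; exact h
  | cons x l ih =>
    rw [isWalkFrom_cons] at h ⊢
    have hx : x ∈ S := hl x (by simp)
    exact ⟨⟨h.1, hu, hx⟩, ih hx (fun y hy => hl y (by simp [hy])) h.2⟩

open Classical in
/-- The finite set of walks of length `n` from `u` to `v`. -/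
noncomputable def walksOfLength [Fintype V] [DecidableEq V] (A : V → V → Prop) :
    ℕ → V → V → Finset (List V)
  | 0, u, v => if u = v then {[]} else ∅
  | n + 1, u, v => (Finset.univ.filter (A u)).biUnion
      fun w => (walksOfLength A n w v).image (List.cons w)

theorem mem_walksOfLength [Fintype V] [DecidableEq V] {n : ℕ} :
    l ∈ walksOfLength A n u v ↔ IsWalkFrom A u v l ∧ l.length = n := by
  induction n generalizing u l with
  | zero =>
    by_cases h : u = v
    · simp only [walksOfLength, h, if_true, Finset.mem_singleton, List.length_eq_zero_iff]
      exact ⟨fun hl => ⟨by rw [hl, isWalkFrom_nil], hl⟩, fun hl => hl.2⟩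
    · simp only [walksOfLength, h, if_false, Finset.notMem_empty, List.length_eq_zero_iff,
        false_iff, not_and]
      rintro hw rfl
      exact h (isWalkFrom_nil.1 hw)
  | succ n ih =>
    cases l with
    | nil => simp [walksOfLength]
    | cons x l => simp [walksOfLength, ih, isWalkFrom_cons, and_assoc]

open Classical in
/-- The adjacency matrix of a relation. -/
noncomputable def relMatrix (A : V → V → Prop) : Matrix V V ℕ :=
  Matrix.of fun u v => if A u v then 1 else 0

theorem relMatrix_pow_apply [Fintype V] [DecidableEq V] (n : ℕ) :
    (relMatrix A ^ n) u v = (walksOfLength A n u v).card := by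
  induction n generalizing u with
  | zero => by_cases h : u = v <;> simp [walksOfLength, h]
  | succ n ih =>
    rw [pow_succ', Matrix.mul_apply, walksOfLength, Finset.card_biUnion]
    · rw [Finset.sum_filter]
      refine Finset.sum_congr rfl fun w _ => ?_
      rw [ih, Finset.card_image_of_injective _ List.cons_injective]
      by_cases h : A u w <;> simp [relMatrix, h]
    · intro x _ y _ hxy
      refine Finset.disjoint_left.2 fun l hx hy => hxy ?_
      obtain ⟨a, -, rfl⟩ := Finset.mem_image.1 hx
      obtain ⟨b, -, hb⟩ := Finset.mem_image.1 hy
      exact (List.cons.inj hb).1.symm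

theorem sum_relMatrix_pow_apply [Fintype V] [DecidableEq V] (k : ℕ) :
    (∑ n ∈ Finset.range (k + 1), relMatrix A ^ n) u v =
      {l | IsWalkFrom A u v l ∧ l.length ≤ k}.ncard := by
  have hset : {l | IsWalkFrom A u v l ∧ l.length ≤ k} =
      ((Finset.range (k + 1)).biUnion fun n => walksOfLength A n u v : Finset (List V)) := by
    ext l
    simp [mem_walksOfLength]
  rw [hset, Set.ncard_coe_finset, Finset.card_biUnion, Matrix.sum_apply]
  · exact Finset.sum_congr rfl fun n _ => relMatrix_pow_apply n
  · intro m _ n _ hmn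
    refine Finset.disjoint_left.2 fun l hm hn => hmn ?_
    rw [← (mem_walksOfLength.1 hm).2, (mem_walksOfLength.1 hn).2]

end Walks

namespace AlmostMooreDigraph

variable {d k : ℕ} (M : AlmostMooreDigraph d k)

theorem ordRep_eq_minimalPeriod (v : M.V) : ordRep M v = Function.minimalPeriod M.rep v := by
  have hpos : 0 < Function.minimalPeriod M.rep v :=
    Function.minimalPeriod_pos_of_mem_periodicPts
      (Function.Injective.mem_periodicPts M.rep_bijective.injective v)
  have hmem : Function.minimalPeriod M.rep v ∈ {t | 0 < t ∧ M.rep^[t] v = v} :=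
    ⟨hpos, Function.iterate_minimalPeriod⟩
  refine le_antisymm (Nat.sInf_le hmem) ?_
  have h := Nat.sInf_mem ⟨_, hmem⟩
  exact Function.IsPeriodicPt.minimalPeriod_le h.1 h.2

variable {M} {α : ℕ} {u v : M.V}

theorem mem_Hset_iff : v ∈ Hset M α ↔ ∃ t : ℕ, M.rep^[2 ^ t * α] v = v := by
  simp only [Hset, Set.mem_ofPred_eq, ordRep_eq_minimalPeriod]
  exact exists_congr fun t => (Function.isPeriodicPt_iff_minimalPeriod_dvd).symm

theorem rep_mem_Hset_iff : M.rep v ∈ Hset M α ↔ v ∈ Hset M α := by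
  simp only [mem_Hset_iff]
  refine exists_congr fun t => ?_
  rw [← Function.iterate_succ_apply, Function.iterate_succ_apply', M.rep_bijective.injective.eq_iff]

theorem iterate_rep_adj (n : ℕ) (h : M.Adj u v) : M.Adj (M.rep^[n] u) (M.rep^[n] v) := by
  induction n with
  | zero => exact h
  | succ n ih =>
    rw [Function.iterate_succ_apply', Function.iterate_succ_apply']
    exact (M.rep_adj _ _).1 ih

theorem exists_eq_or_eq_of_isWalkFrom (u v : M.V) : ∃ l₁ l₂ : List M.V,
    ∀ l, IsWalkFrom M.Adj u v l → l.length ≤ k → l = l₁ ∨ l = l₂ := by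
  by_cases h : v = M.rep u
  · obtain ⟨l₁, l₂, -, -, -, -, -, -, hl⟩ := M.rep_two u
    exact ⟨l₁, l₂, h ▸ hl⟩
  · obtain ⟨l₁, -, hl⟩ := M.rep_spec u v h
    exact ⟨l₁, l₁, fun l h₁ h₂ => Or.inl (hl l ⟨h₁, h₂⟩)⟩

theorem mem_Hset_of_mem_walk (hu : u ∈ Hset M α) (hv : v ∈ Hset M α) {l : List M.V}
    (h : IsWalkFrom M.Adj u v l) (hl : l.length ≤ k) {x : M.V} (hx : x ∈ l) : x ∈ Hset M α := by
  obtain ⟨s, hs⟩ := mem_Hset_iff.1 hu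
  obtain ⟨t, ht⟩ := mem_Hset_iff.1 hv
  set m := 2 ^ (s + t) * α with hm
  have hum : M.rep^[m] u = u :=
    Function.IsPeriodicPt.trans_dvd (m := 2 ^ s * α) hs ⟨2 ^ t, by rw [hm]; ring⟩
  have hvm : M.rep^[m] v = v :=
    Function.IsPeriodicPt.trans_dvd (m := 2 ^ t * α) ht ⟨2 ^ s, by rw [hm]; ring⟩
  have hmap : ∀ {l}, IsWalkFrom M.Adj u v l → IsWalkFrom M.Adj u v (l.map M.rep^[m]) := by
    intro l h
    have := h.map (fun _ _ => iterate_rep_adj m)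
    rwa [hum, hvm] at this
  have hinj : Function.Injective (List.map M.rep^[m]) :=
    List.map_injective_iff.2 (M.rep_bijective.injective.iterate m)
  have hfix : (l.map M.rep^[m]).map M.rep^[m] = l := by
    obtain ⟨l₁, l₂, h₁₂⟩ := exists_eq_or_eq_of_isWalkFrom u v
    have h₀ := h₁₂ _ h hl
    have h₁ := h₁₂ _ (hmap h) (by simpa using hl)
    have h₂ := h₁₂ _ (hmap (hmap h)) (by simpa using hl)
    by_cases he : l.map M.rep^[m] = l
    · rw [he, he]
    · have he' : (l.map M.rep^[m]).map M.rep^[m] ≠ l.map M.rep^[m] := fun h => he (hinj h)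
      grind
  have hxx : M.rep^[m] (M.rep^[m] x) = x := by
    rw [List.map_map] at hfix
    exact List.map_inj_left.1 (hfix.trans (List.map_id l).symm) x hx
  refine mem_Hset_iff.2 ⟨s + t + 1, ?_⟩
  rw [show 2 ^ (s + t + 1) * α = m + m by rw [hm]; ring, Function.iterate_add_apply, hxx]

theorem ncard_walks (u v : M.V) :
    {l | IsWalkFrom M.Adj u v l ∧ l.length ≤ k}.ncard = 1 + if v = M.rep u then 1 else 0 := by
  split_ifs with h
  · obtain ⟨l₁, l₂, hne, h₁, hk₁, h₂, hk₂, -, hl⟩ := M.rep_two u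
    rw [one_add_one_eq_two, ← Set.ncard_pair hne]
    congr 1
    ext l
    subst h
    constructor
    · rintro ⟨hw, hk⟩
      exact hl l hw hk
    · rintro (rfl | rfl)
      exacts [⟨h₁, hk₁⟩, ⟨h₂, hk₂⟩]
  · obtain ⟨l₁, h₁, hl⟩ := M.rep_spec u v h
    rw [add_zero, Set.ncard_eq_one]
    refine ⟨l₁, ?_⟩
    ext l
    exact ⟨fun hw => hl l hw, by rintro rfl; exact h₁⟩

variable (M α) in
/-- The adjacency relation of `H_α`, seen as a relation on all vertices. -/
def HAdj (x y : M.V) : Prop := M.Adj x y ∧ x ∈ Hset M α ∧ y ∈ Hset M α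

theorem HAdj_rep_iff : HAdj M α (M.rep u) (M.rep v) ↔ HAdj M α u v := by
  simp only [HAdj, rep_mem_Hset_iff, ← M.rep_adj]

theorem ncard_HAdj_walks (hu : u ∈ Hset M α) (hv : v ∈ Hset M α) :
    {l | IsWalkFrom (HAdj M α) u v l ∧ l.length ≤ k}.ncard =
      1 + if v = M.rep u then 1 else 0 := by
  rw [← ncard_walks]
  congr 1
  ext l
  exact ⟨fun h => ⟨h.1.mono fun _ _ h => h.1, h.2⟩,
    fun h => ⟨h.1.restrict hu fun _ hx => mem_Hset_of_mem_walk hu hv h.1 h.2 hx, h.2⟩⟩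

end AlmostMooreDigraph

/-- For every vertex `v` of `H_α`, the out-degree of `v` within `H_α`
equals the in-degree of `v` within `H_α`. -/
theorem stmt3 {d k : ℕ} (M : AlmostMooreDigraph d k) (α : ℕ) (hα : 1 < α)
    (v : M.V) (hv : v ∈ Hset M α) :
    {w | w ∈ Hset M α ∧ M.Adj v w}.ncard = {w | w ∈ Hset M α ∧ M.Adj w v}.ncard := by
  classical
  set B := relMatrix (AlmostMooreDigraph.HAdj M α) with hB
  set S := ∑ n ∈ Finset.range (k + 1), B ^ n with hS
  have hcomm : B * S = S * B := by
    rw [hS, Finset.mul_sum, Finset.sum_mul]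
    exact Finset.sum_congr rfl fun n _ => (pow_mul_comm' B n).symm
  have hSapply : ∀ x ∈ Hset M α, ∀ y ∈ Hset M α, S x y = 1 + if y = M.rep x then 1 else 0 :=
    fun x hx y hy => by
      rw [hS, sum_relMatrix_pow_apply, AlmostMooreDigraph.ncard_HAdj_walks hx hy]
  have hzero : ∀ x y, ¬ (x ∈ Hset M α ∧ y ∈ Hset M α) → B x y = 0 := fun x y h => by
    simp only [hB, relMatrix, Matrix.of_apply]
    exact if_neg fun h' => h h'.2
  have hleft : (B * S) v v = ∑ w, B v w + ∑ w, B v w * if v = M.rep w then 1 else 0 := by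
    rw [Matrix.mul_apply, ← Finset.sum_add_distrib]
    refine Finset.sum_congr rfl fun w _ => ?_
    by_cases hw : w ∈ Hset M α
    · rw [hSapply w hw v hv, mul_add, mul_one]
    · simp [hzero v w fun h => hw h.2]
  have hright : (S * B) v v = ∑ w, B w v + ∑ w, (if w = M.rep v then 1 else 0) * B w v := by
    rw [Matrix.mul_apply, ← Finset.sum_add_distrib]
    refine Finset.sum_congr rfl fun w _ => ?_
    by_cases hw : w ∈ Hset M α
    · rw [hSapply v hv w hw, add_mul, one_mul]
    · simp [hzero w v fun h => hw h.1]
  have hrep : ∑ w, B v w * (if v = M.rep w then 1 else 0) =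
      ∑ w, (if w = M.rep v then 1 else 0) * B w v := by
    obtain ⟨z, rfl⟩ := M.rep_bijective.surjective v
    simp only [M.rep_bijective.injective.eq_iff, mul_ite, mul_one, mul_zero, ite_mul, one_mul,
      zero_mul, Finset.sum_ite_eq, Finset.sum_ite_eq', Finset.mem_univ, if_true]
    simp only [hB, relMatrix, Matrix.of_apply, AlmostMooreDigraph.HAdj_rep_iff]
  have hout : {w | w ∈ Hset M α ∧ M.Adj v w}.ncard = ∑ w, B v w := by
    simp only [hB, relMatrix, Matrix.of_apply, Finset.sum_boole, Nat.cast_id]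
    rw [← Set.ncard_coe_finset]
    congr 1
    ext w
    simp [AlmostMooreDigraph.HAdj, hv, and_comm]
  have hin : {w | w ∈ Hset M α ∧ M.Adj w v}.ncard = ∑ w, B w v := by
    simp only [hB, relMatrix, Matrix.of_apply, Finset.sum_boole, Nat.cast_id]
    rw [← Set.ncard_coe_finset]
    congr 1
    ext w
    simp [AlmostMooreDigraph.HAdj, hv, and_comm]
  rw [hout, hin]
  have := congrFun (congrFun hcomm v) v
  rw [hleft, hright, hrep] at this
  exact Nat.add_right_cancel this
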